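/- arXiv:2510.03036 — 3 statements merged into one kernel-verified Lean document; each statement's English description precedes it below -/
import Mathlib

section
/- Assume n ≥ 2 and w_1 ≤ w_2 ≤ … ≤ w_n. Then every w-bubble u satisfies w·u ≤ n · w_{n−1} · (w_n − 2). -/
/-- The weighted dot product `w · u = ∑ i, w i * u i`. -/
def dotW {n : ℕ} (w u : Fin n → ℕ) : ℕ := ∑ i, w i * u i

/-- `d_w`, the least common multiple of the weights. -/
def lcmW {n : ℕ} (w : Fin n → ℕ) : ℕ := Finset.univ.lcm w

/-- `u` is a `w`-bubble: `w · u ≥ 2 d_w` and there is no `v ⪯ u` with `w · v = d_w`. -/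
def IsBubble {n : ℕ} (w u : Fin n → ℕ) : Prop :=
  2 * lcmW w ≤ dotW w u ∧
    ¬ ∃ v : Fin n → ℕ, (∀ i, v i ≤ u i) ∧ dotW w v = lcmW w

/-- A chain of subvectors of `c` with all coordinate sums. -/
lemma exists_chain {n : ℕ} (c : Fin n → ℕ) :
    ∃ f : ℕ → Fin n → ℕ, (∀ j i, f j i ≤ c i) ∧ (∀ j i, f j i ≤ f (j + 1) i) ∧
      ∀ j, j ≤ ∑ i, c i → ∑ i, f j i = j := by
  classical
  have hstep : ∀ x : Fin n → ℕ, ∃ y : Fin n → ℕ, (∀ i, x i ≤ y i) ∧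
      ((∀ i, x i ≤ c i) → (∀ i, y i ≤ c i)) ∧
      ((∑ i, x i < ∑ i, c i) → ∑ i, y i = ∑ i, x i + 1) := by
    intro x
    by_cases h : ∃ i, x i < c i
    · obtain ⟨i, hi⟩ := h
      refine ⟨fun j => x j + if j = i then 1 else 0, ?_, ?_, ?_⟩
      · intro j; simp
      · intro hx j
        have := hx j
        by_cases hj : j = i
        · subst hj; simp; omega
        · simp [hj]; omega
      · intro _
        simp [Finset.sum_add_distrib]
    · push Not at h
      refine ⟨x, fun i => le_rfl, fun h => h, fun h2' => ?_⟩
      have h2 : ∑ i, c i ≤ ∑ i, x i := Finset.sum_le_sum (fun i _ => h i)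
      omega
  choose g hg1 hg2 hg3 using hstep
  refine ⟨fun j => g^[j] (fun _ => 0), ?_, ?_, ?_⟩
  · intro j
    induction j with
    | zero => intro i; simp
    | succ j ih => intro i; simp only [Function.iterate_succ_apply']; exact hg2 _ ih i
  · intro j i
    simp only [Function.iterate_succ_apply']
    exact hg1 _ i
  · intro j
    induction j with
    | zero => intro _; simp
    | succ j ih =>
      intro hj
      have h1 := ih (by omega)
      simp only [Function.iterate_succ_apply'] at h1 ⊢
      rw [hg3 _ (by omega), h1]

/-- Pigeonhole zero-sum lemma. -/
lemma exists_zero_sum {n : ℕ} (w c : Fin n → ℕ) (k : ℕ) (hk : 0 < k) (hc : k ≤ ∑ i, c i) :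
    ∃ x : Fin n → ℕ, (∀ i, x i ≤ c i) ∧ 0 < ∑ i, x i ∧ ∑ i, x i ≤ k ∧ k ∣ ∑ i, w i * x i := by
  obtain ⟨f, hf1, hf2, hf3⟩ := exists_chain c
  have hmono : ∀ i, Monotone (fun j => f j i) := fun i => monotone_nat_of_le_succ (fun j => hf2 j i)
  have key : ∃ a b, a < b ∧ b ≤ k ∧ (∑ i, w i * f a i) % k = (∑ i, w i * f b i) % k := by
    obtain ⟨a, ha, b, hb, hab, he⟩ := Finset.exists_ne_map_eq_of_card_lt_of_maps_to
      (s := Finset.range (k + 1)) (t := Finset.range k) (by simp)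
      (f := fun j => (∑ i, w i * f j i) % k)
      (by intro j _; simp [Nat.mod_lt _ hk])
    simp only [Finset.mem_range] at ha hb
    rcases lt_or_gt_of_ne hab with h | h
    · exact ⟨a, b, h, by omega, he⟩
    · exact ⟨b, a, h, by omega, he.symm⟩
  obtain ⟨a, b, hab, hb, he⟩ := key
  have hle : ∀ i, f a i ≤ f b i := fun i => hmono i hab.le
  have hs : ∑ i, (f b i - f a i) + ∑ i, f a i = ∑ i, f b i := by
    rw [← Finset.sum_add_distrib]
    exact Finset.sum_congr rfl (fun i _ => Nat.sub_add_cancel (hle i))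
  rw [hf3 a (by omega), hf3 b (by omega)] at hs
  have hd : ∑ i, w i * (f b i - f a i) + ∑ i, w i * f a i = ∑ i, w i * f b i := by
    rw [← Finset.sum_add_distrib]
    refine Finset.sum_congr rfl (fun i _ => ?_)
    rw [← mul_add, Nat.sub_add_cancel (hle i)]
  refine ⟨fun i => f b i - f a i, fun i => (Nat.sub_le _ _).trans (hf1 b i),
    by show 0 < ∑ i, (f b i - f a i); omega, by show ∑ i, (f b i - f a i) ≤ k; omega, ?_⟩
  have h2 := (Nat.modEq_iff_dvd' (show ∑ i, w i * f a i ≤ ∑ i, w i * f b i by omega)).1 he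
  show k ∣ ∑ i, w i * (f b i - f a i)
  have h3 : ∑ i, w i * (f b i - f a i) = ∑ i, w i * f b i - ∑ i, w i * f a i := by omega
  rw [h3]; exact h2

lemma dvd_lcmW {n : ℕ} (w : Fin n → ℕ) (i : Fin n) : w i ∣ lcmW w :=
  Finset.dvd_lcm (Finset.mem_univ i)

lemma dotW_add_single {n : ℕ} (w v : Fin n → ℕ) (i : Fin n) (t : ℕ) :
    dotW w (fun j => v j + if j = i then t else 0) = dotW w v + w i * t := by
  simp [dotW, mul_add, Finset.sum_add_distrib]

lemma dotW_add {n : ℕ} (w v x : Fin n → ℕ) :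
    dotW w (fun j => v j + x j) = dotW w v + dotW w x := by
  simp [dotW, mul_add, Finset.sum_add_distrib]

lemma bubble_coord_lt {n : ℕ} (w : Fin n → ℕ) (u : Fin n → ℕ) (hu : IsBubble w u)
    (i : Fin n) : w i * (u i + 1) ≤ lcmW w := by
  obtain ⟨t, ht⟩ := dvd_lcmW w i
  rw [ht]
  refine Nat.mul_le_mul_left _ ?_
  by_contra h
  refine hu.2 ⟨fun j => 0 + if j = i then t else 0, ?_, ?_⟩
  · intro j
    by_cases hj : j = i
    · subst hj; simp; omega
    · simp [hj]
  · rw [dotW_add_single w (fun _ => 0), ht]; simp [dotW]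

lemma bubble_core {n : ℕ} (w : Fin n → ℕ) (u : Fin n → ℕ) (hu : IsBubble w u)
    (hw : ∀ i, 0 < w i) (i : Fin n) (M : ℕ) (hM : ∀ j, j ≠ i → w j ≤ M)
    (hui : M ≤ u i + 1) (hd : (w i - 1) * M ≤ lcmW w) : False := by
  classical
  set d := lcmW w with hdd
  let P : ℕ → Prop := fun s => ∃ v : Fin n → ℕ, (∀ j, v j ≤ u j) ∧ v i = 0 ∧ w i ∣ s ∧ dotW w v = s
  have hP0 : P 0 := ⟨fun _ => 0, by simp, rfl, by simp, by simp [dotW]⟩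
  obtain ⟨v, hvu, hvi, hdv, hs⟩ : P (Nat.findGreatest P d) :=
    Nat.findGreatest_spec (Nat.zero_le d) hP0
  have hsd : Nat.findGreatest P d ≤ d := Nat.findGreatest_le d
  have hmax : ∀ s, P s → s ≤ d → s ≤ Nat.findGreatest P d :=
    fun s h1 h2 => Nat.le_findGreatest h2 h1
  generalize Nat.findGreatest P d = s at *
  have hdvd : w i ∣ d - s := Nat.dvd_sub (dvd_lcmW w i) hdv
  obtain ⟨t, ht⟩ := hdvd
  by_cases htu : t ≤ u i
  · refine hu.2 ⟨fun j => v j + if j = i then t else 0, ?_, ?_⟩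
    · intro j
      by_cases hj : j = i
      · subst hj; simp [hvi, htu]
      · simp [hj, hvu j]
    · rw [dotW_add_single, hs]; omega
  · have ht1 : w i * (u i + 1) ≤ d - s := by
      rw [ht]; exact Nat.mul_le_mul_left _ (by omega)
    let c : Fin n → ℕ := fun j => if j = i then 0 else u j - v j
    have hc : dotW w u = dotW w c + s + w i * u i := by
      rw [← hs, ← dotW_add, ← dotW_add_single]
      congr 1
      funext j
      by_cases hj : j = i
      · subst hj; simp [c, hvi]
      · have := hvu j
        simp [c, hj]; omega
    have hcM : dotW w c ≤ (∑ j, c j) * M := by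
      rw [dotW, Finset.sum_mul]
      refine Finset.sum_le_sum (fun j _ => ?_)
      by_cases hj : j = i
      · simp [c, hj]
      · rw [mul_comm]; exact Nat.mul_le_mul_left _ (hM j hj)
    have hu1 := hu.1
    rw [← hdd] at hu1
    have hwi := hw i
    have hcount : w i ≤ ∑ j, c j := by
      by_contra h
      have h1 : (∑ j, c j) * M ≤ (w i - 1) * M := Nat.mul_le_mul_right _ (by omega)
      have h2 : w i * (u i + 1) = w i * u i + w i := by ring
      omega
    obtain ⟨x, hx1, hx2, hx3, hx4⟩ := exists_zero_sum w c (w i) hwi hcount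
    have hxi : x i = 0 := by have := hx1 i; simpa [c] using this
    have hxM : dotW w x ≤ (∑ j, x j) * M := by
      rw [dotW, Finset.sum_mul]
      refine Finset.sum_le_sum (fun j _ => ?_)
      by_cases hj : j = i
      · rw [hj, hxi]; simp
      · rw [mul_comm]; exact Nat.mul_le_mul_left _ (hM j hj)
    have hxle : (∑ j, x j) * M ≤ w i * (u i + 1) := Nat.mul_le_mul hx3 hui
    have hxpos : ∑ j, x j ≤ dotW w x :=
      Finset.sum_le_sum (fun j _ => Nat.le_mul_of_pos_left _ (hw j))
    have := hmax (s + dotW w x) ⟨fun j => v j + x j, ?_, by simp [hvi, hxi], Nat.dvd_add hdv hx4,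
      by rw [dotW_add, hs]⟩ (by omega)
    · omega
    · intro j
      have h1 := hx1 j
      have h2 := hvu j
      by_cases hj : j = i
      · subst hj; simp [hvi, hxi]
      · simp only [c, hj, if_false] at h1
        show v j + x j ≤ u j
        omega

theorem bubble_dot_le_of_monotone {n : ℕ} (hn : 2 ≤ n) (w : Fin n → ℕ)
    (hw : ∀ i, 0 < w i) (hmono : Monotone w) (u : Fin n → ℕ) (hu : IsBubble w u) :
    (dotW w u : ℤ) ≤ (n : ℤ) * (w ⟨n - 2, by omega⟩ : ℤ) * ((w ⟨n - 1, by omega⟩ : ℤ) - 2) := by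
  by_contra hcon
  have hn1 : n - 1 < n := by omega
  have hex : ∃ i, (w ⟨n - 2, by omega⟩ : ℤ) * ((w ⟨n - 1, by omega⟩ : ℤ) - 2) < w i * u i := by
    by_contra h
    push Not at h
    apply hcon
    have := Finset.sum_le_card_nsmul Finset.univ (fun i => (w i * u i : ℤ)) _ (fun i _ => h i)
    simp only [Finset.card_univ, Fintype.card_fin, nsmul_eq_mul] at this
    rw [dotW]; push_cast; rw [mul_assoc]; exact this
  obtain ⟨i, hi⟩ := hex
  have hlt := bubble_coord_lt w u hu i
  have hab : w ⟨n - 2, by omega⟩ ≤ w ⟨n - 1, by omega⟩ := hmono (by simp [Fin.le_def]; omega)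
  have ha := hw ⟨n - 2, by omega⟩
  have hpi := hw i
  by_cases hin : i = ⟨n - 1, hn1⟩
  · subst hin
    refine bubble_core w u hu hw ⟨n - 1, hn1⟩ (w ⟨n - 2, by omega⟩) ?_ ?_ ?_
    · intro j hj
      apply hmono
      have : j.val ≠ n - 1 := fun h => hj (Fin.ext h)
      rw [Fin.le_def]
      show j.val ≤ n - 2
      omega
    · generalize w ⟨n - 2, _⟩ = a at *
      generalize w ⟨n - 1, _⟩ = b at *
      by_contra h
      have h : (u ⟨n - 1, by omega⟩ : ℤ) ≤ a - 2 := by omega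
      generalize u ⟨n - 1, _⟩ = t at *
      zify at *
      nlinarith
    · generalize w ⟨n - 2, _⟩ = a at *
      generalize w ⟨n - 1, _⟩ = b at *
      generalize u ⟨n - 1, _⟩ = t at *
      obtain ⟨b, rfl⟩ : ∃ e, b = e + 1 := ⟨b - 1, by omega⟩
      simp only [Nat.add_sub_cancel]
      zify at *
      nlinarith
  · have hia : w i ≤ w ⟨n - 2, by omega⟩ := by
      apply hmono
      have : i.val ≠ n - 1 := fun h => hin (Fin.ext h)
      rw [Fin.le_def]
      show i.val ≤ n - 2
      omega
    refine bubble_core w u hu hw i (w ⟨n - 1, by omega⟩) ?_ ?_ ?_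
    · intro j hj
      apply hmono
      rw [Fin.le_def]
      show j.val ≤ n - 1
      omega
    · generalize w ⟨n - 2, _⟩ = a at *
      generalize w ⟨n - 1, _⟩ = b at *
      by_contra h
      have h2' : (u i : ℤ) ≤ b - 2 := by omega
      have h0 : (0 : ℤ) ≤ u i := by positivity
      generalize u i = t at *
      generalize w i = c at *
      zify at *
      nlinarith [mul_nonneg (sub_nonneg.2 hia) (h0.trans h2'), mul_le_mul_of_nonneg_left h2' hpi.le]
    · generalize w ⟨n - 2, _⟩ = a at *
      generalize w ⟨n - 1, _⟩ = b at *
      generalize u i = t at *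
      generalize w i = c at *
      obtain ⟨c, rfl⟩ : ∃ e, c = e + 1 := ⟨c - 1, by omega⟩
      simp only [Nat.add_sub_cancel]
      have hb : 1 ≤ b := by omega
      zify at *
      nlinarith [mul_nonneg (sub_nonneg.2 hia) (sub_nonneg.2 hb)]
end

section
/- Assume n ≥ 2 and that w = (w_1, …, w_n) is well-formed, i.e. for every i ∈ {1, …, n}, the greatest common divisor of the weights w_j with j ≠ i equals 1. Then every w-bubble u satisfies w·u < (n−1)·d_w. -/
/-- Edge points: for `i ≠ j`, the lattice points on the edge `ij` of the simplex are avoided. -/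
theorem bubble_edge {n : ℕ} (w u a : Fin n → ℕ) (d : ℕ) (ha : ∀ i, w i * a i = d) (hd : 0 < d)
    (hb : ¬ ∃ v : Fin n → ℕ, (∀ i, v i ≤ u i) ∧ dotW w v = d)
    {i j : Fin n} (hij : i ≠ j) :
    (1 : ℚ) - 1 / (Nat.gcd (a i) (a j) : ℕ) + 1 / a i + 1 / a j
      ≤ (1 - (u i : ℚ) / a i) + (1 - (u j : ℚ) / a j) := by
  have hapos : ∀ i, 0 < a i := fun i => Nat.pos_of_ne_zero (by
    intro h; have := ha i; rw [h] at this; omega)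
  obtain ⟨g, hg⟩ : ∃ g, g = Nat.gcd (a i) (a j) := ⟨_, rfl⟩
  rw [← hg]
  have hgpos : 0 < g := hg ▸ Nat.gcd_pos_of_pos_left _ (hapos i)
  obtain ⟨α, hα⟩ : g ∣ a i := hg ▸ Nat.gcd_dvd_left _ _
  obtain ⟨β, hβ⟩ : g ∣ a j := hg ▸ Nat.gcd_dvd_right _ _
  have hαpos : 0 < α := Nat.pos_of_ne_zero (by
    rintro rfl; have := hapos i; rw [hα] at this; simp at this)
  have hβpos : 0 < β := Nat.pos_of_ne_zero (by
    rintro rfl; have := hapos j; rw [hβ] at this; simp at this)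
  have hab : w i * α = w j * β := by
    have h1 := ha i
    have h2 := ha j
    rw [hα] at h1
    rw [hβ] at h2
    apply Nat.eq_of_mul_eq_mul_left hgpos
    calc g * (w i * α) = w i * (g * α) := by ring
      _ = w j * (g * β) := by rw [h1, h2]
      _ = g * (w j * β) := by ring
  have key : ∀ k l : ℕ, k + l = g → k * α ≤ u i → u j < l * β := by
    intro k l hk h1
    by_contra! h2
    apply hb
    refine ⟨fun t => if t = i then k * α else if t = j then l * β else 0, ?_, ?_⟩
    · intro t
      dsimp only
      split_ifs with h h'
      · exact h ▸ h1
      · exact h' ▸ h2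
      · exact Nat.zero_le _
    · unfold dotW
      rw [Finset.sum_eq_add_of_mem i j (Finset.mem_univ _) (Finset.mem_univ _) hij]
      · dsimp only
        rw [if_pos rfl, if_neg hij.symm, if_pos rfl]
        calc w i * (k * α) + w j * (l * β) = k * (w i * α) + l * (w j * β) := by ring
          _ = (k + l) * (w i * α) := by rw [← hab]; ring
          _ = w i * (g * α) := by rw [hk]; ring
          _ = d := by rw [← hα, ha]
      · intro c _ hc
        simp [hc.1, hc.2]
  have hui : u i < g * α := by
    by_contra! h
    have := key g 0 (by simp) h
    simp at this
  have hk : u i / α < g := Nat.div_lt_of_lt_mul (by rw [mul_comm]; exact hui)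
  obtain ⟨k, hkdef⟩ : ∃ k, k = u i / α := ⟨_, rfl⟩
  rw [← hkdef] at hk
  obtain ⟨l, hl⟩ := Nat.exists_eq_add_of_lt hk
  have h1 : k * α ≤ u i := by rw [hkdef]; exact Nat.div_mul_le_self _ _
  have h2 : u i + 1 ≤ (k + 1) * α := by
    rw [hkdef, mul_comm]; exact Nat.lt_mul_div_succ _ hαpos
  have h3 : u j + 1 ≤ (l + 1) * β := key k (l + 1) (by omega) h1
  have hg' : (g : ℚ) = k + l + 1 := by rw [hl]; push_cast; ring
  have hgq : (0 : ℚ) < g := by exact_mod_cast hgpos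
  have hαq : (0 : ℚ) < α := by exact_mod_cast hαpos
  have hβq : (0 : ℚ) < β := by exact_mod_cast hβpos
  have h2q : (u i : ℚ) + 1 ≤ (k + 1) * α := by exact_mod_cast h2
  have h3q : (u j : ℚ) + 1 ≤ (l + 1) * β := by exact_mod_cast h3
  have e1 : ((u i : ℚ) + 1) / a i ≤ (k + 1) / g := by
    rw [hα]; push_cast
    rw [div_le_div_iff₀ (by positivity) hgq]
    nlinarith
  have e2 : ((u j : ℚ) + 1) / a j ≤ (l + 1) / g := by
    rw [hβ]; push_cast
    rw [div_le_div_iff₀ (by positivity) hgq]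
    nlinarith
  have e3 : ((k : ℚ) + 1) / g + (l + 1) / g = 1 + 1 / g := by
    rw [hg'] at *
    field_simp
    ring
  rw [add_div] at e1 e2
  linarith

/-- Well-formedness: each `a j` divides the product of the others. -/
theorem wf_dvd_prod {n : ℕ} (w a : Fin n → ℕ) (d : ℕ) (ha : ∀ i, w i * a i = d) (hd : 0 < d)
    (hwf : ∀ i : Fin n, (Finset.univ.erase i).gcd w = 1) (j : Fin n) :
    a j ∣ ∏ k ∈ Finset.univ.erase j, a k := by
  have hm : (Finset.univ.erase j).lcm a ∣ d :=
    Finset.lcm_dvd fun k _ => ⟨w k, by rw [mul_comm]; exact (ha k).symm⟩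
  obtain ⟨t, ht⟩ := hm
  have ht1 : t ∣ 1 := by
    rw [← hwf j]
    refine Finset.dvd_gcd fun k hk => ?_
    obtain ⟨s, hs⟩ := Finset.dvd_lcm (f := a) hk
    have hak : 0 < a k := Nat.pos_of_ne_zero (by
      intro h; have := ha k; rw [h] at this; omega)
    refine ⟨s, Nat.eq_of_mul_eq_mul_left hak ?_⟩
    calc a k * w k = d := by rw [mul_comm]; exact ha k
      _ = a k * s * t := by rw [ht, hs]
      _ = a k * (t * s) := by ring
  have ht2 : t = 1 := Nat.dvd_one.mp ht1
  rw [ht2, mul_one] at ht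
  have h1 : a j ∣ d := ⟨w j, by rw [mul_comm]; exact (ha j).symm⟩
  rw [ht] at h1
  exact h1.trans (Finset.lcm_dvd fun k hk => Finset.dvd_prod_of_mem a hk)

theorem triangle_ineq (x y z A B C : ℚ) (hx : 0 ≤ x) (hy : 0 ≤ y) (hz : 0 ≤ z)
    (hx' : x ≤ 1 / 2) (hy' : y ≤ 1 / 2) (hz' : z ≤ 1 / 2)
    (hA : x * y ≤ A) (hB : x * z ≤ B) (hC : y * z ≤ C) :
    2 < 3 - (x + y + z) + 2 * (A + B + C) := by
  nlinarith [mul_nonneg hx hy, mul_nonneg hx hz, mul_nonneg hy hz,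
    mul_nonneg (sub_nonneg.2 hx') (sub_nonneg.2 hy'),
    mul_nonneg (sub_nonneg.2 hx') (sub_nonneg.2 hz'),
    mul_nonneg (sub_nonneg.2 hy') (sub_nonneg.2 hz')]

theorem bubble_dot_lt_of_wellFormed {n : ℕ} (hn : 2 ≤ n) (w : Fin n → ℕ)
    (hw : ∀ i, 0 < w i) (hwf : ∀ i : Fin n, (Finset.univ.erase i).gcd w = 1)
    (u : Fin n → ℕ) (hu : IsBubble w u) :
    dotW w u < (n - 1) * lcmW w := by
  obtain ⟨-, hb⟩ := hu
  have hd : 0 < lcmW w := Nat.pos_of_ne_zero (by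
    unfold lcmW
    rw [Ne, Finset.lcm_eq_zero_iff]
    rintro ⟨i, -, hi⟩
    exact (hw i).ne' hi)
  have hdvd : ∀ i, w i ∣ lcmW w := fun i => Finset.dvd_lcm (Finset.mem_univ i)
  generalize lcmW w = d at *
  choose a ha' using hdvd
  have ha : ∀ i, w i * a i = d := fun i => (ha' i).symm
  clear ha'
  by_contra! hcon
  have hapos : ∀ i, 0 < a i := fun i => Nat.pos_of_ne_zero (by
    intro h; have := ha i; rw [h] at this; omega)
  have haq : ∀ i, (0 : ℚ) < a i := fun i => by exact_mod_cast hapos i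
  have hdq : (0 : ℚ) < d := by exact_mod_cast hd
  obtain ⟨z, hz⟩ : ∃ z : Fin n → ℚ, z = fun i => 1 - (u i : ℚ) / a i := ⟨_, rfl⟩
  have hedge : ∀ i j, i ≠ j →
      (1 : ℚ) - 1 / (Nat.gcd (a i) (a j) : ℕ) + 1 / a i + 1 / a j ≤ z i + z j := by
    intro i j hij
    rw [hz]
    exact bubble_edge w u a d ha hd hb hij
  have hz0 : ∀ i, 0 ≤ z i := by
    intro i
    rw [hz]
    have : u i ≤ a i := by
      by_contra! h
      apply hb
      refine ⟨fun t => if t = i then a i else 0, ?_, ?_⟩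
      · intro t
        dsimp only
        split_ifs with h'
        · exact h' ▸ h.le
        · exact Nat.zero_le _
      · unfold dotW
        simp [ha]
    have h2 : (u i : ℚ) / a i ≤ 1 := by
      rw [div_le_one (haq i)]; exact_mod_cast this
    simp only
    linarith
  have hsum : ∑ i, z i ≤ 1 := by
    have h1 : ∑ i, (u i : ℚ) / a i = (dotW w u : ℚ) / d := by
      unfold dotW
      push_cast
      rw [Finset.sum_div]
      refine Finset.sum_congr rfl fun i _ => ?_
      have h2 : (w i : ℚ) * a i = d := by exact_mod_cast ha i
      rw [div_eq_div_iff (haq i).ne' hdq.ne', ← h2]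
      ring
    have h3 : ((n : ℚ) - 1) ≤ (dotW w u : ℚ) / d := by
      rw [le_div_iff₀ hdq]
      have h4 : (((n - 1 : ℕ) : ℚ)) * d ≤ (dotW w u : ℚ) := by exact_mod_cast hcon
      rwa [Nat.cast_sub (by omega), Nat.cast_one] at h4
    rw [hz, Finset.sum_sub_distrib, h1]
    simp
    linarith
  have hsub : ∀ s : Finset (Fin n), ∑ i ∈ s, z i ≤ 1 := fun s =>
    (Finset.sum_le_sum_of_subset_of_nonneg (Finset.subset_univ s) fun i _ _ => hz0 i).trans hsum
  have hprod := wf_dvd_prod w a d ha hd hwf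
  -- no divisibilities
  have hndvd : ∀ i j, i ≠ j → ¬ a j ∣ a i := by
    intro i j hij h
    have h1 := hedge i j hij
    rw [Nat.gcd_eq_right h] at h1
    have h2 := hsub {i, j}
    rw [Finset.sum_pair hij] at h2
    have : (0 : ℚ) < 1 / a i := by have := haq i; positivity
    linarith
  have hhalf : ∀ i j, Nat.gcd (a i) (a j) ≠ 1 → (1 : ℚ) / (Nat.gcd (a i) (a j) : ℕ) ≤ 1 / 2 := by
    intro i j h
    have h1 : 0 < Nat.gcd (a i) (a j) := Nat.gcd_pos_of_pos_left _ (hapos i)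
    have h2 : (2 : ℚ) ≤ (Nat.gcd (a i) (a j) : ℕ) := by
      have : 2 ≤ Nat.gcd (a i) (a j) := by omega
      exact_mod_cast this
    exact one_div_le_one_div_of_le (by norm_num) h2
  -- no two disjoint edges
  have hdisj : ∀ i j k l, i ≠ j → i ≠ k → i ≠ l → j ≠ k → j ≠ l → k ≠ l →
      Nat.gcd (a i) (a j) ≠ 1 → Nat.gcd (a k) (a l) ≠ 1 → False := by
    intro i j k l hij hik hil hjk hjl hkl h1 h2
    have e1 := hedge i j hij
    have e2 := hedge k l hkl
    have e3 := hhalf i j h1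
    have e4 := hhalf k l h2
    have e5 := hsub {i, j, k, l}
    rw [Finset.sum_insert (by simp [hij, hik, hil]), Finset.sum_insert (by simp [hjk, hjl]),
      Finset.sum_pair hkl] at e5
    have p1 : (0 : ℚ) < 1 / a i := by have := haq i; positivity
    have p2 : (0 : ℚ) < 1 / a j := by have := haq j; positivity
    have p3 : (0 : ℚ) < 1 / a k := by have := haq k; positivity
    have p4 : (0 : ℚ) < 1 / a l := by have := haq l; positivity
    linarith
  -- degree at least two
  have hdeg : ∀ j i, i ≠ j → ∃ k, k ≠ i ∧ k ≠ j ∧ Nat.gcd (a j) (a k) ≠ 1 := by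
    intro j i hij
    by_contra! h
    apply hndvd i j hij
    have h1 := hprod j
    rw [← Finset.mul_prod_erase _ _ (Finset.mem_erase.2 ⟨hij, Finset.mem_univ i⟩)] at h1
    refine Nat.Coprime.dvd_of_dvd_mul_right (Nat.Coprime.prod_right fun k hk => ?_) h1
    simp only [Finset.mem_erase] at hk
    exact h k hk.1 hk.2.1
  obtain ⟨q, -, hqp, hpq⟩ := hdeg ⟨0, by omega⟩ ⟨1, by omega⟩ (by simp)
  generalize (⟨0, by omega⟩ : Fin n) = p at *
  obtain ⟨r, hrq, hrp, hpr⟩ := hdeg p q hqp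
  obtain ⟨m, hmp, hmq, hqm⟩ := hdeg q p hqp.symm
  have hmr : m = r := by
    by_contra hmr
    exact hdisj p r q m hrp.symm hqp.symm (Ne.symm hmp) hrq (Ne.symm hmr) (Ne.symm hmq) hpr hqm
  subst hmr
  -- the triangle `p q m`
  have htri : ∀ i j k, i ≠ j → i ≠ k → j ≠ k → Nat.gcd (a j) (a k) ≠ 1 →
      (1 : ℚ) / (Nat.gcd (a i) (a j) : ℕ) * (1 / (Nat.gcd (a i) (a k) : ℕ)) ≤ 1 / a i := by
    intro i j k hij hik hjk hg
    have h1 := hprod i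
    rw [← Finset.mul_prod_erase _ _ (Finset.mem_erase.2 ⟨hij.symm, Finset.mem_univ j⟩),
      ← Finset.mul_prod_erase _ _ (Finset.mem_erase.2 ⟨hjk.symm,
        Finset.mem_erase.2 ⟨hik.symm, Finset.mem_univ k⟩⟩), ← mul_assoc] at h1
    have h2 : a i ∣ a j * a k := by
      refine Nat.Coprime.dvd_of_dvd_mul_right (Nat.Coprime.prod_right fun l hl => ?_) h1
      simp only [Finset.mem_erase] at hl
      by_contra hc
      exact hdisj i l j k (Ne.symm hl.2.2.1) hij hik hl.2.1 hl.1 hjk hc hg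
    have h3 : a i ∣ Nat.gcd (a i) (a j) * Nat.gcd (a i) (a k) :=
      (Nat.dvd_gcd dvd_rfl h2).trans (Nat.gcd_mul_right_dvd_mul_gcd _ _ _)
    have g1 : 0 < Nat.gcd (a i) (a j) := Nat.gcd_pos_of_pos_left _ (hapos i)
    have g2 : 0 < Nat.gcd (a i) (a k) := Nat.gcd_pos_of_pos_left _ (hapos i)
    have h4 := Nat.le_of_dvd (Nat.mul_pos g1 g2) h3
    rw [one_div_mul_one_div]
    exact one_div_le_one_div_of_le (haq i) (by exact_mod_cast h4)
  have t1 := htri p q m hqp.symm hrp.symm (Ne.symm hmq) hqm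
  have t2 := htri q p m hqp (Ne.symm hmq) hrp.symm hpr
  have t3 := htri m p q hrp hmq hqp.symm hpq
  rw [Nat.gcd_comm (a q) (a p)] at t2
  rw [Nat.gcd_comm (a m) (a p), Nat.gcd_comm (a m) (a q)] at t3
  have e1 := hedge p q hqp.symm
  have e2 := hedge p m hrp.symm
  have e3 := hedge q m (Ne.symm hmq)
  have e5 := hsub {p, q, m}
  rw [Finset.sum_insert (by simp [hqp.symm, hrp.symm]), Finset.sum_pair (Ne.symm hmq)] at e5
  have := triangle_ineq _ _ _ _ _ _ (by positivity) (by positivity) (by positivity)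
    (hhalf p q hpq) (hhalf p m hpr) (hhalf q m hqm) t1 t2 t3
  linarith
end

section
/- Every w-bubble u satisfies w·u < lcm(1, 2, …, max(w_1, …, w_n)). -/
/-- Every multiset of at least `m` naturals has a nonempty submultiset of at most `m`
elements with sum divisible by `m`. -/
theorem exists_zero_sum_s18 (m : ℕ) (hm : 0 < m) (R : Multiset ℕ) (hR : m ≤ Multiset.card R) :
    ∃ V ≤ R, 0 < Multiset.card V ∧ Multiset.card V ≤ m ∧ m ∣ V.sum := by
  induction R using Quotient.inductionOn with
  | _ l =>
  change m ≤ l.length at hR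
  obtain ⟨i, hi, j, hj, hij, h⟩ := Finset.exists_ne_map_eq_of_card_lt_of_maps_to
    (s := Finset.range (m + 1)) (t := Finset.range m) (f := fun i => (l.take i).sum % m)
    (by simp) (by intro i _; simpa using Nat.mod_lt _ hm)
  have key : ∀ i j : ℕ, i < j → j < m + 1 → (l.take i).sum % m = (l.take j).sum % m →
      ∃ V ≤ (l : Multiset ℕ), 0 < Multiset.card V ∧ Multiset.card V ≤ m ∧ m ∣ V.sum := by
    intro i j hij hj h
    refine ⟨((l.take j).drop i : List ℕ), ?_, ?_, ?_, ?_⟩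
    · exact Multiset.coe_le.2 (((List.drop_sublist _ _).trans (List.take_sublist _ _)).subperm)
    · simp; omega
    · simp; omega
    · have e : (l.take j).sum = (l.take i).sum + ((l.take j).drop i).sum := by
        rw [← List.sum_take_add_sum_drop (l.take j) i, List.take_take, min_eq_left hij.le]
      rw [Multiset.sum_coe]
      rw [e] at h
      have h2 : (l.take i).sum + 0 ≡ (l.take i).sum + ((l.take j).drop i).sum [MOD m] := by
        simpa [Nat.ModEq] using h
      exact (Nat.modEq_zero_iff_dvd).1 (Nat.ModEq.add_left_cancel' _ h2).symm
  simp only [Finset.mem_range] at hi hj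
  rcases lt_or_gt_of_ne hij with hlt | hlt
  · exact key i j hlt hj h
  · exact key j i hlt hi h.symm

theorem sum_le_card_mul (M : ℕ) (R : Multiset ℕ) (h : ∀ x ∈ R, x ≤ M) :
    R.sum ≤ Multiset.card R * M := by
  simpa using Multiset.sum_le_card_nsmul R M h

/-- Greedy filling. -/
theorem greedy_fill (M m c : ℕ) (hm : 0 < m) (hc : M ≤ c + 1) (k : ℕ) :
    ∀ (R : Multiset ℕ) (e : ℕ), Multiset.card R = k → (∀ x ∈ R, x ≤ M) → m ∣ e →
      e + (m - 1) * M ≤ R.sum + m * c → ∃ V ≤ R, ∃ j ≤ c, V.sum + m * j = e := by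
  induction k using Nat.strong_induction_on with
  | _ k ih =>
  intro R e hk hR hme hsum
  by_cases hcard : m ≤ Multiset.card R
  · obtain ⟨V, hV, hV0, hVm, hVd⟩ := exists_zero_sum_s18 m hm R hcard
    by_cases hle : V.sum ≤ e
    · obtain ⟨W, rfl⟩ := Multiset.le_iff_exists_add.1 hV
      rw [Multiset.card_add] at hk
      rw [Multiset.sum_add] at hsum
      obtain ⟨V', hV', j, hj, hs⟩ := ih (Multiset.card W) (by omega) W (e - V.sum) rfl
        (fun x hx => hR x (Multiset.mem_add.2 (Or.inr hx))) (Nat.dvd_sub hme hVd) (by omega)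
      refine ⟨V + V', by gcongr, j, hj, ?_⟩
      rw [Multiset.sum_add]; omega
    · obtain ⟨j, rfl⟩ := hme
      refine ⟨0, Multiset.zero_le _, j, ?_, by simp⟩
      have h1 := sum_le_card_mul M V (fun x hx => hR x (Multiset.mem_of_le hV hx))
      have h2 : Multiset.card V * M ≤ m * M := Nat.mul_le_mul_right _ hVm
      have h3 : m * j < m * M := by omega
      have := Nat.lt_of_mul_lt_mul_left h3
      omega
  · obtain ⟨j, rfl⟩ := hme
    refine ⟨0, Multiset.zero_le _, j, ?_, by simp⟩
    have h1 := sum_le_card_mul M R hR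
    have h2 : Multiset.card R * M ≤ (m - 1) * M := Nat.mul_le_mul_right _ (by omega)
    exact Nat.le_of_mul_le_mul_left (by omega : m * j ≤ m * c) hm

theorem exists_sub_of_count (M m d : ℕ) (S : Multiset ℕ) (hS : ∀ x ∈ S, x ≤ M)
    (hm : 0 < m) (hmM : m ≤ M) (hmd : m ∣ d) (hc : M ≤ S.count m + 1)
    (hsum : d + (M - 1) * M ≤ S.sum) : ∃ V ≤ S, V.sum = d := by
  have hsplit := Multiset.filter_add_not (p := fun a => a = m) S
  rw [Multiset.filter_eq'] at hsplit
  have hs : S.sum = S.count m * m + (S.filter (fun a => ¬ a = m)).sum := by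
    conv_lhs => rw [← hsplit]
    simp
  have h2 : (m - 1) * M ≤ (M - 1) * M := Nat.mul_le_mul_right _ (by omega)
  obtain ⟨V, hV, j, hj, h⟩ := greedy_fill M m (S.count m) hm hc _
    (S.filter (fun a => ¬ a = m)) d rfl
    (fun x hx => hS x (Multiset.mem_of_mem_filter hx)) hmd (by
      rw [mul_comm m]; omega)
  refine ⟨Multiset.replicate j m + V, ?_, ?_⟩
  · rw [← hsplit]
    exact add_le_add ((Multiset.replicate_le_replicate m).2 hj) hV
  · simp; rw [← h]; ring

theorem lcm_big (M : ℕ) (hM : 7 ≤ M) :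
    (M - 2) * (M * (M + 1)) < 2 * (Finset.Icc 1 M).lcm id := by
  by_cases h : M < 15
  · interval_cases M <;> decide +kernel
  · obtain ⟨k, rfl⟩ := Nat.exists_eq_add_of_le (not_lt.1 h)
    have h1 : (k + 13) * (k + 15) * (k + 16) ^ 2 < 2 ^ (k + 16) := by
      clear h hM
      induction k with
      | zero => norm_num
      | succ k ih =>
        have hp : 2 ^ (k + 1 + 16) = 2 * 2 ^ (k + 16) := by ring
        rw [hp]
        nlinarith [sq_nonneg k, Nat.zero_le (k^3), Nat.zero_le (k^4), Nat.zero_le k]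
    have h2 := Chebyshev.two_pow_le_mul_lcmUpto (15 + k)
    rw [Nat.lcmUpto] at h2
    set L := (Finset.Icc 1 (15 + k)).lcm id
    have h3 : 15 + k - 2 = k + 13 := by omega
    rw [h3]
    have h4 : 2 ^ (k + 16) = 2 * 2 ^ (15 + k) := by rw [show k + 16 = (15 + k) + 1 by ring]; ring
    by_contra hcon
    push Not at hcon
    nlinarith

theorem lcm_big' (M : ℕ) (hM : 7 ≤ M) :
    2 * (M - 1) * M ≤ (Finset.Icc 1 M).lcm id := by
  have := lcm_big M hM
  obtain ⟨k, rfl⟩ := Nat.exists_eq_add_of_le hM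
  have h1 : 7 + k - 2 = k + 5 := by omega
  have h2 : 7 + k - 1 = k + 6 := by omega
  rw [h1] at this
  rw [h2]
  nlinarith

theorem sum_eq_count (M : ℕ) (S : Multiset ℕ) (hS : ∀ x ∈ S, 0 < x ∧ x ≤ M) :
    S.sum = ∑ m ∈ Finset.Icc 1 M, S.count m * m := by
  rw [Finset.sum_multiset_count_of_subset S (Finset.Icc 1 M)]
  · simp
  · intro x hx
    have := hS x (by simpa using hx)
    simp; omega

theorem no_bubble (M d : ℕ) (S : Multiset ℕ) (hM : 0 < M) (hS : ∀ x ∈ S, 0 < x ∧ x ≤ M ∧ x ∣ d)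
    (hMd : M ∣ d) (hd0 : 0 < d) (hdL : d ∣ (Finset.Icc 1 M).lcm id) (h2 : 2 * d ≤ S.sum)
    (hL : (Finset.Icc 1 M).lcm id ≤ S.sum) (hno : ¬ ∃ V ≤ S, V.sum = d) : False := by
  have hcount0 : ∀ m, ¬ m ∣ d → S.count m = 0 := fun m h =>
    Multiset.count_eq_zero.2 fun hm => h (hS m hm).2.2
  have hcap : ∀ m, S.count m * m < d := by
    intro m
    by_contra hcon
    push Not at hcon
    by_cases hmd : m ∣ d
    · obtain ⟨j, rfl⟩ := hmd
      have hm : 0 < m := Nat.pos_of_mul_pos_right hd0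
      refine hno ⟨Multiset.replicate j m, ?_, by simp [mul_comm]⟩
      rw [← Multiset.le_count_iff_replicate_le]
      rw [mul_comm] at hcon
      exact Nat.le_of_mul_le_mul_right hcon hm
    · rw [hcount0 m hmd] at hcon; omega
  have hsum := sum_eq_count M S (fun x hx => ⟨(hS x hx).1, (hS x hx).2.1⟩)
  have hA : d + (M - 1) * M ≤ S.sum → ∀ m, 0 < m → m ≤ M → S.count m + 2 ≤ M ∨ ¬ m ∣ d := by
    intro h m hm hmM
    by_contra hcon
    push Not at hcon
    exact hno (exists_sub_of_count M m d S (fun x hx => (hS x hx).2.1) hm hmM hcon.2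
      (by omega) h)
  have hA' : d + (M - 1) * M ≤ S.sum → 2 ≤ M → ∀ m, 0 < m → m ≤ M → S.count m ≤ M - 2 := by
    intro h hM2 m hm hmM
    rcases hA h m hm hmM with h | h
    · omega
    · rw [hcount0 m h]; omega
  by_cases h7 : 7 ≤ M
  · have b1 := lcm_big M h7
    have b2 := lcm_big' M h7
    have hc := hA' (by rw [mul_assoc] at b2; omega) (by omega)
    have : S.sum ≤ ∑ m ∈ Finset.Icc 1 M, (M - 2) * m := by
      rw [hsum]
      refine Finset.sum_le_sum fun m hm => ?_
      rw [Finset.mem_Icc] at hm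
      exact Nat.mul_le_mul_right _ (hc m hm.1 hm.2)
    rw [← Finset.mul_sum] at this
    have g : (∑ m ∈ Finset.Icc 1 M, m) * 2 = M * (M + 1) := by
      have := Finset.sum_range_id_mul_two (M + 1)
      rw [Finset.sum_range_eq_add_Ico _ (by omega)] at this
      simp only [zero_add, Nat.add_sub_cancel] at this
      rw [mul_comm M, ← this]; rfl
    have : 2 * S.sum ≤ (M - 2) * (M * (M + 1)) := by rw [← g]; nlinarith
    omega
  · have hM7 : M < 7 := by omega
    have c1 := hcap 1
    have c2 := hcap 2
    have c3 := hcap 3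
    have c4 := hcap 4
    have c5 := hcap 5
    have c6 := hcap 6
    have n2 := hcount0 2
    have n3 := hcount0 3
    have n4 := hcount0 4
    have n5 := hcount0 5
    have hv : ∀ a b : ℕ, a ≤ S.count 6 → b ≤ S.count 3 → a * 6 + b * 3 ≠ d := by
      intro a b ha hb hab
      refine hno ⟨Multiset.replicate a 6 + Multiset.replicate b 3, ?_, by simpa using hab⟩
      rw [Multiset.le_iff_count]
      intro x
      simp only [Multiset.count_add, Multiset.count_replicate]
      split_ifs <;> (subst_vars; omega)
    have v1 := hv 4 2
    have v2 := hv 3 4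
    have a1 := fun h h' => hA' h h' 1
    have a2 := fun h h' => hA' h h' 2
    have a3 := fun h h' => hA' h h' 3
    have a4 := fun h h' => hA' h h' 4
    have a5 := fun h h' => hA' h h' 5
    have a6 := fun h h' => hA' h h' 6
    have aa := fun h => hA h 1
    clear hcap hcount0 hno hA hA' hv hS
    have e1 : (Finset.Icc 1 1).lcm id = 1 := by decide +kernel
    have e2 : (Finset.Icc 1 2).lcm id = 2 := by decide +kernel
    have e3 : (Finset.Icc 1 3).lcm id = 6 := by decide +kernel
    have e4 : (Finset.Icc 1 4).lcm id = 12 := by decide +kernel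
    have e5 : (Finset.Icc 1 5).lcm id = 60 := by decide +kernel
    have e6 : (Finset.Icc 1 6).lcm id = 60 := by decide +kernel
    interval_cases M
    · rw [e1] at hL hdL
      have := Nat.le_of_dvd (by norm_num) hdL
      simp at hsum
      omega
    · rw [e2] at hL hdL
      have := Nat.le_of_dvd (by norm_num) hdL
      simp [Finset.sum_Icc_succ_top] at hsum
      omega
    · rw [e3] at hL hdL
      have := Nat.le_of_dvd (by norm_num) hdL
      simp [Finset.sum_Icc_succ_top] at hsum
      interval_cases d <;> omega
    · rw [e4] at hL hdL
      have := Nat.le_of_dvd (by norm_num) hdL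
      simp [Finset.sum_Icc_succ_top] at hsum
      interval_cases d <;> omega
    · rw [e5] at hL hdL
      have := Nat.le_of_dvd (by norm_num) hdL
      simp [Finset.sum_Icc_succ_top] at hsum
      omega
    · rw [e6] at hL hdL
      have := Nat.le_of_dvd (by norm_num) hdL
      simp [Finset.sum_Icc_succ_top] at hsum
      have : d = 6 ∨ d = 12 ∨ d = 30 ∨ d = 60 := by
        clear * - hdL hMd this hd0
        interval_cases d <;> omega
      rcases this with rfl | rfl | rfl | rfl <;> omega

theorem exists_le_of_le_map {α : Type*} (f : α → ℕ) (S : Multiset α) (V : Multiset ℕ)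
    (h : V ≤ S.map f) : ∃ V' ≤ S, V'.map f = V := by
  induction S using Quotient.inductionOn with
  | _ l =>
  induction V using Quotient.inductionOn with
  | _ v =>
  obtain ⟨v', hp, hs⟩ := (Multiset.coe_le.1 h : v.Subperm (l.map f))
  obtain ⟨t, ht, rfl⟩ := List.sublist_map_iff.1 hs
  exact ⟨(t : Multiset α), Multiset.coe_le.2 ht.subperm, Quot.sound hp⟩

theorem bubble_dot_lt_lcm_range {n : ℕ} (hn : 0 < n) (w : Fin n → ℕ) (hw : ∀ i, 0 < w i)
    (u : Fin n → ℕ) (hu : IsBubble w u) :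
    dotW w u < (Finset.Icc 1 (Finset.univ.sup w)).lcm id := by
  by_contra hcon
  push Not at hcon
  obtain ⟨h2, hno⟩ := hu
  have hle : ∀ i, w i ≤ Finset.univ.sup w := fun i => Finset.le_sup (Finset.mem_univ i)
  have hdiv : ∀ i, w i ∣ lcmW w := fun i => Finset.dvd_lcm (Finset.mem_univ i)
  obtain ⟨i0, -, hi0⟩ := Finset.exists_mem_eq_sup (Finset.univ : Finset (Fin n))
    ⟨⟨0, hn⟩, Finset.mem_univ _⟩ w
  have hdot : ∀ T : Multiset (Fin n), (T.map w).sum = dotW w (fun i => T.count i) := by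
    intro T
    rw [Finset.sum_multiset_map_count, dotW]
    rw [Finset.sum_subset (Finset.subset_univ _)]
    · simp [mul_comm]
    · intro i _ hi
      simp at hi
      simp [hi]
  let S0 : Multiset (Fin n) := ∑ i, Multiset.replicate (u i) i
  have hcnt : ∀ i, S0.count i = u i := by
    intro i
    simp [S0, Multiset.count_sum', Multiset.count_replicate]
  have hS0 : (S0.map w).sum = dotW w u := by rw [hdot]; simp only [hcnt]
  refine no_bubble (Finset.univ.sup w) (lcmW w) (S0.map w) ?_ ?_ ?_ ?_ ?_ ?_ ?_ ?_
  · rw [hi0]; exact hw i0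
  · intro x hx
    obtain ⟨i, -, rfl⟩ := Multiset.mem_map.1 hx
    exact ⟨hw i, hle i, hdiv i⟩
  · rw [hi0]; exact hdiv i0
  · refine Nat.pos_of_ne_zero fun h => ?_
    rw [lcmW, Finset.lcm_eq_zero_iff] at h
    obtain ⟨i, -, hi⟩ := h
    exact (hw i).ne' hi
  · refine Finset.lcm_dvd fun i _ => ?_
    exact Finset.dvd_lcm (f := id) (Finset.mem_Icc.2 ⟨hw i, hle i⟩)
  · rw [hS0]; exact h2
  · rw [hS0]; exact hcon
  · rintro ⟨V, hV, hs⟩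
    obtain ⟨V', hV', rfl⟩ := exists_le_of_le_map w S0 V hV
    refine hno ⟨fun i => V'.count i, fun i => ?_, ?_⟩
    · rw [← hcnt i]; exact Multiset.count_le_of_le _ hV'
    · rw [← hdot]; exact hs
end
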